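/- Two-variable example with an exactly-L² potential: Fix 0 < ε < 1/2 and define on (D_{1/2} \ {0}) × (D_{1/2} \ {0}): u₀(z₁,z₂) = e^{−(−ln|z₁|)^ε} e^{−(−ln|z₂|)^ε} and V(z₁,z₂) = (ε/2) ( 1/(|z₁|²(−ln|z₁|)^{2−2ε}) + 1/(|z₂|²(−ln|z₂|)^{2−2ε}) )^{1/2}. Then: (i) V ∈ L²(D_{1/2} × D_{1/2}); (ii) V ∉ L^p(D_{1/2} × D_{1/2}) for every p > 2; and (iii) u₀ is differentiable on (D_{1/2} \ {0}) × (D_{1/2} \ {0}) and satisfies |∂̄u₀(z₁,z₂)| = V(z₁,z₂)|u₀(z₁,z₂)| there, where |∂̄u₀| = (|∂̄₁u₀|² + |∂̄₂u₀|²)^{1/2}. -/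

import Mathlib

open MeasureTheory Metric

/-- The first (pointwise) `∂̄`-operator on `ℂ²`:
`∂̄₁u(z) = (∂_{x_1} u(z) + i ∂_{y_1} u(z))/2`, from the real Fréchet derivative. -/
noncomputable def dbar1 (u : ℂ × ℂ → ℂ) (z : ℂ × ℂ) : ℂ :=
  (fderiv ℝ u z (1, 0) + Complex.I * fderiv ℝ u z (Complex.I, 0)) / 2

/-- The second (pointwise) `∂̄`-operator on `ℂ²`:
`∂̄₂u(z) = (∂_{x_2} u(z) + i ∂_{y_2} u(z))/2`, from the real Fréchet derivative. -/
noncomputable def dbar2 (u : ℂ × ℂ → ℂ) (z : ℂ × ℂ) : ℂ :=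
  (fderiv ℝ u z (0, 1) + Complex.I * fderiv ℝ u z (0, Complex.I)) / 2

/-- The function `u₀(z₁,z₂) = e^{−(−ln|z₁|)^ε} e^{−(−ln|z₂|)^ε}`. -/
noncomputable def uLog2 (ε : ℝ) (z : ℂ × ℂ) : ℂ :=
  ((Real.exp (-((-Real.log ‖z.1‖) ^ ε)) * Real.exp (-((-Real.log ‖z.2‖) ^ ε)) : ℝ) : ℂ)

/-- The potential
`V(z₁,z₂) = (ε/2)(1/(|z₁|²(−ln|z₁|)^{2−2ε}) + 1/(|z₂|²(−ln|z₂|)^{2−2ε}))^{1/2}`. -/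
noncomputable def VLog2 (ε : ℝ) (z : ℂ × ℂ) : ℝ :=
  (ε / 2) * Real.sqrt (1 / (‖z.1‖ ^ 2 * (-Real.log ‖z.1‖) ^ (2 - 2 * ε)) +
    1 / (‖z.2‖ ^ 2 * (-Real.log ‖z.2‖) ^ (2 - 2 * ε)))

/-- The one-variable radial profile `1/(r²(−ln r)^a)`. -/
noncomputable def logProfile (a r : ℝ) : ℝ := 1 / (r ^ 2 * (-Real.log r) ^ a)

lemma neg_log_pos_of_mem_Ioo {r : ℝ} (h0 : 0 < r) (h1 : r < 1) : 0 < -Real.log r :=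
  neg_pos.2 (Real.log_neg h0 h1)

lemma logProfile_nonneg (a : ℝ) {r : ℝ} (h0 : 0 ≤ r) (h1 : r ≤ 1) : 0 ≤ logProfile a r := by
  have : 0 ≤ -Real.log r := neg_nonneg.2 (Real.log_nonpos h0 h1)
  unfold logProfile
  positivity

lemma measurable_logProfile (a : ℝ) : Measurable (logProfile a) := by
  unfold logProfile
  fun_prop

lemma continuousOn_neg_log_rpow {s b : ℝ} (hs : s < 0) (hb : b < 1) :
    ContinuousOn (fun r : ℝ => (-Real.log r) ^ s) (Set.Icc 0 b) := by
  intro r hr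
  rcases hr.1.eq_or_lt with rfl | h0
  · rw [← continuousWithinAt_sdiff_singleton (s := Set.Icc (0 : ℝ) b) (y := 0)]
    have ht : Filter.Tendsto (fun r : ℝ => (-Real.log r) ^ s) (nhdsWithin 0 (Set.Ioi 0))
        (nhds 0) := by
      have h := (tendsto_rpow_neg_atTop (neg_pos.2 hs)).comp
        (Filter.tendsto_neg_atBot_atTop.comp Real.tendsto_log_nhdsGT_zero)
      simpa [Function.comp_def] using h
    have hv : (-Real.log 0) ^ s = 0 := by
      simp [Real.zero_rpow hs.ne]
    simp only [ContinuousWithinAt, hv]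
    exact ht.mono_left (nhdsWithin_mono _ fun x hx => lt_of_le_of_ne hx.1.1 (Ne.symm hx.2))
  · have hL := neg_log_pos_of_mem_Ioo h0 (hr.2.trans_lt hb)
    exact ((Real.continuousAt_log h0.ne').neg.rpow_const (Or.inl hL.ne')).continuousWithinAt

lemma integrableOn_mul_logProfile {a b : ℝ} (ha : 1 < a) (hb : b < 1) :
    IntegrableOn (fun r : ℝ => r * logProfile a r) (Set.Ioo 0 b) := by
  have key : IntegrableOn (fun r : ℝ => (a - 1) * (r * logProfile a r)) (Set.Ioc 0 b) := by
    refine intervalIntegral.integrableOn_deriv_of_nonneg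
      (continuousOn_neg_log_rpow (s := 1 - a) (by linarith) hb) (fun r hr => ?_) (fun r hr => ?_)
    · have hL := neg_log_pos_of_mem_Ioo hr.1 (hr.2.trans hb)
      have hr0 := hr.1.ne'
      convert! ((Real.hasDerivAt_log hr0).neg.rpow_const (p := 1 - a) (Or.inl hL.ne')) using 1
      have : (1 - a - 1 : ℝ) = -a := by ring
      rw [this, Pi.neg_apply, Real.rpow_neg hL.le, logProfile]
      have := (Real.rpow_pos_of_pos hL a).ne'
      field_simp
      ring
    · exact mul_nonneg (by linarith) (mul_nonneg hr.1.le
        (logProfile_nonneg a hr.1.le (hr.2.trans hb).le))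
  have := (key.mono_set Set.Ioo_subset_Ioc_self).const_mul (a - 1)⁻¹
  refine this.congr (Filter.Eventually.of_forall fun r => ?_)
  have : a - 1 ≠ 0 := by linarith
  simp only
  field_simp

lemma integrableOn_logProfile_norm {a b : ℝ} (ha : 1 < a) (hb : b < 1) :
    IntegrableOn (fun z : ℂ => logProfile a ‖z‖) (ball 0 b) := by
  rw [integrableOn_fun_norm_addHaar volume]
  simpa [Complex.finrank_real_complex] using integrableOn_mul_logProfile ha hb

lemma inv_le_mul_sqrt_logProfile_rpow {a p r : ℝ} (h0 : 0 < r) (h1 : r < 1)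
    (h : (-Real.log r) ^ (a * p / 2) ≤ r ^ (2 - p)) :
    r ^ (-1 : ℝ) ≤ r * Real.sqrt (logProfile a r) ^ p := by
  have hL := neg_log_pos_of_mem_Ioo h0 h1
  have e : Real.sqrt (logProfile a r) ^ p = r ^ (-p) * ((-Real.log r) ^ (a * p / 2))⁻¹ := by
    rw [logProfile, Real.sqrt_eq_rpow, ← Real.rpow_mul (by positivity), one_div,
      Real.inv_rpow (by positivity), Real.mul_rpow (by positivity) (by positivity),
      ← Real.rpow_natCast, ← Real.rpow_mul h0.le, ← Real.rpow_mul hL.le, mul_inv,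
      ← Real.rpow_neg h0.le]
    congr 2 <;> [skip; congr 1] <;> push_cast <;> ring
  have h2 : r ^ (p - 2) ≤ ((-Real.log r) ^ (a * p / 2))⁻¹ := by
    rw [← neg_sub, Real.rpow_neg h0.le]
    exact inv_anti₀ (Real.rpow_pos_of_pos hL _) h
  calc r ^ (-1 : ℝ) = r * (r ^ (-p) * r ^ (p - 2)) := by
        rw [← Real.rpow_add h0, ← Real.rpow_one_add' h0.le (by ring_nf; norm_num)]
        ring_nf
    _ ≤ _ := by
        rw [e]
        gcongr

lemma not_integrableOn_sqrt_logProfile_norm_rpow (a : ℝ) {p b : ℝ} (hp : 2 < p) (hb : 0 < b) :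
    ¬ IntegrableOn (fun z : ℂ => Real.sqrt (logProfile a ‖z‖) ^ p) (ball 0 b) := by
  rw [integrableOn_fun_norm_addHaar volume (f := fun r => Real.sqrt (logProfile a r) ^ p)]
  simp only [Complex.finrank_real_complex, Nat.add_one_sub_one, pow_one, smul_eq_mul]
  intro hint
  have hev := (isLittleO_abs_log_rpow_rpow_nhdsGT_zero (a * p / 2)
    (show (2 - p : ℝ) < 0 by linarith)).bound one_pos
  obtain ⟨δ, hδ, hsub⟩ := mem_nhdsGT_iff_exists_Ioo_subset.1 hev
  set c := min δ (min b 1)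
  have hc : 0 < c := lt_min hδ (lt_min hb one_pos)
  have hcb : c ≤ b := (min_le_right _ _).trans (min_le_left _ _)
  have hc1 : c ≤ 1 := (min_le_right _ _).trans (min_le_right _ _)
  have : IntegrableOn (fun r : ℝ => r ^ (-1 : ℝ)) (Set.Ioo 0 c) := by
    refine (hint.mono_set (Set.Ioo_subset_Ioo_right hcb)).mono'
      (by fun_prop) ?_
    refine ae_restrict_of_forall_mem measurableSet_Ioo fun r hr => ?_
    have hr1 := hr.2.trans_le hc1
    have hL := neg_log_pos_of_mem_Ioo hr.1 hr1
    rw [Real.norm_of_nonneg (Real.rpow_nonneg hr.1.le _)]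
    refine inv_le_mul_sqrt_logProfile_rpow hr.1 hr1 ?_
    have hb := hsub ⟨hr.1, hr.2.trans_le (min_le_left _ _)⟩
    simp only [Set.mem_ofPred_eq, one_mul] at hb
    rwa [Real.norm_of_nonneg (by positivity),
      Real.norm_of_nonneg (Real.rpow_nonneg hr.1.le _), ← abs_neg, abs_of_pos hL] at hb
  rw [intervalIntegral.integrableOn_Ioo_rpow_iff hc] at this
  exact lt_irrefl _ this

lemma VLog2_eq (ε : ℝ) (z : ℂ × ℂ) : VLog2 ε z = (ε / 2) *
    Real.sqrt (logProfile (2 - 2 * ε) ‖z.1‖ + logProfile (2 - 2 * ε) ‖z.2‖) := rfl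

lemma norm_le_one_of_mem_ball_half {z : ℂ} (hz : z ∈ ball (0 : ℂ) (1 / 2)) : ‖z‖ ≤ 1 := by
  rw [mem_ball_zero_iff] at hz
  linarith

lemma setLIntegral_VLog2_sq_lt_top {ε : ℝ} (hε : ε < 1 / 2) :
    (∫⁻ z in ball (0 : ℂ) (1 / 2) ×ˢ ball (0 : ℂ) (1 / 2),
      ENNReal.ofReal (VLog2 ε z ^ 2)) < ⊤ := by
  set B := ball (0 : ℂ) (1 / 2)
  set a := 2 - 2 * ε with ha
  have hfin : IsFiniteMeasure (volume.restrict B) := ⟨by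
    rw [Measure.restrict_apply_univ]
    exact measure_ball_lt_top⟩
  have hI : IntegrableOn (fun z : ℂ => logProfile a ‖z‖) B :=
    integrableOn_logProfile_norm (by linarith) (by norm_num)
  have hsum : IntegrableOn (fun z : ℂ × ℂ => (ε / 2) ^ 2 *
      (logProfile a ‖z.1‖ + logProfile a ‖z.2‖)) (B ×ˢ B) := by
    rw [IntegrableOn, Measure.volume_eq_prod, ← Measure.prod_restrict]
    exact ((hI.integrable.comp_fst _).add (hI.integrable.comp_snd _)).const_mul _
  refine lt_of_le_of_lt (setLIntegral_mono_ae' (by measurability) ?_) hsum.lintegral_lt_top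
  refine Filter.Eventually.of_forall fun z hz => ENNReal.ofReal_le_ofReal (le_of_eq ?_)
  rw [VLog2_eq, mul_pow, Real.sq_sqrt]
  exact add_nonneg (logProfile_nonneg _ (norm_nonneg _) (norm_le_one_of_mem_ball_half hz.1))
    (logProfile_nonneg _ (norm_nonneg _) (norm_le_one_of_mem_ball_half hz.2))

lemma setLIntegral_VLog2_rpow_eq_top {ε p : ℝ} (hε0 : 0 < ε) (hp : 2 < p) :
    (∫⁻ z in ball (0 : ℂ) (1 / 2) ×ˢ ball (0 : ℂ) (1 / 2),
      ENNReal.ofReal (VLog2 ε z ^ p)) = ⊤ := by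
  set B := ball (0 : ℂ) (1 / 2)
  set a := 2 - 2 * ε
  set g : ℂ → ℝ := fun z => (ε / 2) ^ p * Real.sqrt (logProfile a ‖z‖) ^ p with hg
  have hmeas : Measurable g := by
    have := measurable_logProfile a
    fun_prop
  have hnn : ∀ z, 0 ≤ g z := fun z => by positivity
  have htop : ∫⁻ z in B, ENNReal.ofReal (g z) = ⊤ := by
    by_contra hne
    have hint : IntegrableOn g B := (lintegral_ofReal_ne_top_iff_integrable
      hmeas.aestronglyMeasurable (Filter.Eventually.of_forall hnn)).1 hne
    refine not_integrableOn_sqrt_logProfile_norm_rpow a hp (b := 1 / 2) (by norm_num)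
      ((hint.const_mul ((ε / 2) ^ p)⁻¹).congr (Filter.Eventually.of_forall fun z => ?_))
    have : (ε / 2) ^ p ≠ 0 := (Real.rpow_pos_of_pos (by positivity) p).ne'
    simp only [hg]
    field_simp
  have hle : ∫⁻ z in B ×ˢ B, ENNReal.ofReal (g z.1) ≤
      ∫⁻ z in B ×ˢ B, ENNReal.ofReal (VLog2 ε z ^ p) := by
    refine setLIntegral_mono_ae' (by measurability)
      (Filter.Eventually.of_forall fun z hz => ENNReal.ofReal_le_ofReal ?_)
    have h2 := logProfile_nonneg a (norm_nonneg _) (norm_le_one_of_mem_ball_half hz.2)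
    rw [VLog2_eq, Real.mul_rpow (by positivity) (by positivity)]
    simp only [hg]
    gcongr
    linarith
  refine top_unique (le_trans (le_of_eq ?_) hle)
  rw [Measure.volume_eq_prod, ← Measure.prod_restrict,
    lintegral_prod _ (by fun_prop)]
  simp only [lintegral_const, Measure.restrict_apply_univ]
  rw [lintegral_mul_const _ (by fun_prop), htop, ENNReal.top_mul]
  exact (measure_ball_pos _ _ (by norm_num)).ne'

lemma hasFDerivAt_exp_neg_neg_log_norm_rpow (ε : ℝ) {z : ℂ} (h0 : z ≠ 0) (h1 : ‖z‖ < 1) :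
    HasFDerivAt (fun w : ℂ => Real.exp (-((-Real.log ‖w‖) ^ ε)))
      ((Real.exp (-((-Real.log ‖z‖) ^ ε)) * (ε * (-Real.log ‖z‖) ^ (ε - 1) / ‖z‖ ^ 2)) •
        innerSL ℝ z) z := by
  have hn : 0 < ‖z‖ := norm_pos_iff.2 h0
  have hL := neg_log_pos_of_mem_Ioo hn h1
  have hlog : HasFDerivAt (fun w : ℂ => Real.log ‖w‖) ((‖z‖ ^ 2)⁻¹ • innerSL ℝ z) z := by
    have h := ((hasStrictFDerivAt_norm_sq z).hasFDerivAt.log (by positivity)).const_mul (1 / 2 : ℝ)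
    convert! h using 1
    · funext w
      rw [Real.log_pow]
      push_cast
      ring
    · ext w
      simp
      ring
  have hd := (((Real.hasDerivAt_rpow_const (x := -Real.log ‖z‖) (p := ε)
    (Or.inl hL.ne')).comp_hasFDerivAt z hlog.neg).neg).exp
  convert! hd using 1
  ext w
  simp
  ring

/-- The norm of the `∂̄`-derivative of the real linear form `w ↦ k⟪z, w⟫` on `ℂ`. -/
lemma norm_smul_innerSL_dbar (k : ℝ) (z : ℂ) :
    ‖(((k * inner ℝ z 1 : ℝ) : ℂ) + Complex.I * ((k * inner ℝ z Complex.I : ℝ) : ℂ)) / 2‖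
      = |k| * ‖z‖ / 2 := by
  have : (((k * inner ℝ z 1 : ℝ) : ℂ) + Complex.I * ((k * inner ℝ z Complex.I : ℝ) : ℂ))
      = k * z := by
    apply Complex.ext <;> simp [Complex.inner]
  rw [this]
  simp

lemma sq_logDeriv_eq_logProfile (ε : ℝ) {r : ℝ} (h0 : 0 < r) (h1 : r < 1) (m : ℝ) :
    (|m * (ε * (-Real.log r) ^ (ε - 1) / r ^ 2)| * r / 2) ^ 2
      = (ε / 2) ^ 2 * logProfile (2 - 2 * ε) r * m ^ 2 := by
  have hL := neg_log_pos_of_mem_Ioo h0 h1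
  have e : (-Real.log r) ^ (2 - 2 * ε) = (((-Real.log r) ^ (ε - 1)) ^ 2)⁻¹ := by
    rw [← Real.rpow_natCast, ← Real.rpow_mul hL.le, ← Real.rpow_neg hL.le]
    congr 1
    push_cast
    ring
  have := (Real.rpow_pos_of_pos hL (ε - 1)).ne'
  rw [div_pow, mul_pow, sq_abs, logProfile, e]
  field_simp

lemma uLog2_differentiableAt_and_norm_dbar {ε : ℝ} (hε0 : 0 < ε) {z : ℂ × ℂ}
    (h1 : ‖z.1‖ < 1) (h2 : ‖z.2‖ < 1) (n1 : z.1 ≠ 0) (n2 : z.2 ≠ 0) :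
    DifferentiableAt ℝ (uLog2 ε) z ∧
      Real.sqrt (‖dbar1 (uLog2 ε) z‖ ^ 2 + ‖dbar2 (uLog2 ε) z‖ ^ 2)
        = VLog2 ε z * ‖uLog2 ε z‖ := by
  set F : ℂ → ℝ := fun w => Real.exp (-((-Real.log ‖w‖) ^ ε)) with hF
  set k : ℂ → ℝ := fun w => ε * (-Real.log ‖w‖) ^ (ε - 1) / ‖w‖ ^ 2 with hk
  have d1 : HasFDerivAt (fun w : ℂ × ℂ => F w.1) _ z :=
    (hasFDerivAt_exp_neg_neg_log_norm_rpow ε n1 h1).comp z hasFDerivAt_fst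
  have d2 : HasFDerivAt (fun w : ℂ × ℂ => F w.2) _ z :=
    (hasFDerivAt_exp_neg_neg_log_norm_rpow ε n2 h2).comp z hasFDerivAt_snd
  have hd : HasFDerivAt (uLog2 ε) _ z :=
    Complex.ofRealCLM.hasFDerivAt.comp z (d1.mul d2)
  have e1 : ‖dbar1 (uLog2 ε) z‖ = |(F z.1 * F z.2) * k z.1| * ‖z.1‖ / 2 := by
    rw [← norm_smul_innerSL_dbar, dbar1, hd.fderiv]
    congr 2
    simp [hF, hk]
    ring
  have e2 : ‖dbar2 (uLog2 ε) z‖ = |(F z.1 * F z.2) * k z.2| * ‖z.2‖ / 2 := by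
    rw [← norm_smul_innerSL_dbar, dbar2, hd.fderiv]
    congr 2
    simp [hF, hk]
    ring
  have hu : ‖uLog2 ε z‖ = F z.1 * F z.2 := by
    rw [uLog2, Complex.norm_real, Real.norm_of_nonneg (by positivity)]
  refine ⟨hd.differentiableAt, ?_⟩
  rw [e1, e2, sq_logDeriv_eq_logProfile ε (norm_pos_iff.2 n1) h1,
    sq_logDeriv_eq_logProfile ε (norm_pos_iff.2 n2) h2, hu, VLog2_eq,
    mul_right_comm (ε / 2) (Real.sqrt _),
    ← Real.sqrt_sq (show 0 ≤ ε / 2 * (F z.1 * F z.2) by positivity),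
    ← Real.sqrt_mul (sq_nonneg _)]
  congr 1
  ring

/-- **Two-variable example with an exactly-`L²` potential.**  Fix `0 < ε < 1/2`.  Then, with
`u₀` and `V` as above on `(D_{1/2} \ {0}) × (D_{1/2} \ {0})`:
(i) `V ∈ L²(D_{1/2} × D_{1/2})`; (ii) `V ∉ L^p(D_{1/2} × D_{1/2})` for every `p > 2`;
(iii) `u₀` is differentiable there and `|∂̄u₀| = V|u₀|` there. -/
theorem two_variable_exactly_L2_potential_example (ε : ℝ) (hε0 : 0 < ε) (hε : ε < 1 / 2) :
    (∫⁻ z in ball (0 : ℂ) (1 / 2) ×ˢ ball (0 : ℂ) (1 / 2),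
        ENNReal.ofReal (VLog2 ε z ^ 2)) < ⊤ ∧
    (∀ p : ℝ, 2 < p →
      (∫⁻ z in ball (0 : ℂ) (1 / 2) ×ˢ ball (0 : ℂ) (1 / 2),
        ENNReal.ofReal (VLog2 ε z ^ p)) = ⊤) ∧
    (∀ z : ℂ × ℂ, z.1 ∈ ball (0 : ℂ) (1 / 2) → z.2 ∈ ball (0 : ℂ) (1 / 2) →
      z.1 ≠ 0 → z.2 ≠ 0 →
      DifferentiableAt ℝ (uLog2 ε) z ∧
      Real.sqrt (‖dbar1 (uLog2 ε) z‖ ^ 2 + ‖dbar2 (uLog2 ε) z‖ ^ 2)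
        = VLog2 ε z * ‖uLog2 ε z‖) := by
  refine ⟨setLIntegral_VLog2_sq_lt_top hε, fun p hp => setLIntegral_VLog2_rpow_eq_top hε0 hp,
    fun z h1 h2 n1 n2 => ?_⟩
  rw [mem_ball_zero_iff] at h1 h2
  exact uLog2_differentiableAt_and_norm_dbar hε0 (by linarith) (by linarith) n1 n2
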